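/- Let g : ℝⁿ → ℝ be of class C³ satisfying ∇g(x)·x ≥ c₀|x|² − a₀ for all x ∈ ℝⁿ (with a₀ ≥ 0, c₀ > 0). Let ξ ∈ ℝⁿ be a critical point of g such that the Hessian ∇²g(ξ) is positive semidefinite, ker ∇²g(ξ) = span(ℓ) for some ℓ ∈ ℝⁿ, ℓ ≠ 0, and the third derivative satisfies Σ_{i,j,k} ∂³g/∂x_i∂x_j∂x_k(ξ) ℓ_i ℓ_j ℓ_k ≠ 0. Then: (existence) there exists a nonconstant solution w : ℝ → ℝⁿ of ẇ(s) = −∇g(w(s)) with lim_{s→−∞} w(s) = ξ; (uniqueness up to time-translation) any two nonconstant solutions w₁, w₂ of this problem satisfy w₂(s) = w₁(s + c) for all s ∈ ℝ, for some constant c ∈ ℝ. -/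

import Mathlib

open Set Filter Topology
open scoped RealInnerProductSpace

/-- A function which is nonincreasing wherever it is at least `m` cannot cross the level `m`
upwards. -/
lemma le_of_deriv_nonpos_above {f f' : ℝ → ℝ} {a b m : ℝ} (hab : a ≤ b)
    (hf : ∀ x ∈ Icc a b, HasDerivAt f (f' x) x) (ha : f a ≤ m)
    (h : ∀ x ∈ Icc a b, m ≤ f x → f' x ≤ 0) : f b ≤ m := by
  refine le_of_forall_pos_le_add fun ε hε => ?_
  set η : ℝ := ε / (b - a + 1) with hη
  have hba : 0 < b - a + 1 := by linarith
  have hηpos : 0 < η := by positivity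
  have key := image_le_of_deriv_right_lt_deriv_boundary (f := f) (f' := f') (a := a) (b := b)
    (B := fun x => m + η * (x - a)) (B' := fun _ => η)
    (fun x hx => (hf x hx).continuousAt.continuousWithinAt)
    (fun x hx => (hf x (Ico_subset_Icc_self hx)).hasDerivWithinAt) (by simpa using ha)
    (fun x => by simpa using (((hasDerivAt_id x).sub_const a).const_mul η).const_add m)
    (fun x hx hxe => lt_of_le_of_lt (h x (Ico_subset_Icc_self hx) (by
      have : 0 ≤ η * (x - a) := mul_nonneg hηpos.le (by linarith [hx.1])
      linarith)) hηpos) (right_mem_Icc.2 hab)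
  have : η * (b - a) ≤ ε := by
    rw [hη, div_mul_eq_mul_div, div_le_iff₀ hba]
    nlinarith
  linarith

section Autonomous

variable {E : Type*} [NormedAddCommGroup E] [NormedSpace ℝ E]

/-- Two global solutions of an autonomous equation with a `C¹` right-hand side that meet at some
time coincide. -/
lemma eq_of_hasDerivAt_of_contDiff {V : E → E} (hV : ContDiff ℝ 1 V) {w₁ w₂ : ℝ → E}
    (h₁ : ∀ s, HasDerivAt w₁ (V (w₁ s)) s) (h₂ : ∀ s, HasDerivAt w₂ (V (w₂ s)) s)
    {s₀ : ℝ} (h₀ : w₁ s₀ = w₂ s₀) : w₁ = w₂ := by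
  have c₁ : Continuous w₁ := continuous_iff_continuousAt.2 fun s => (h₁ s).continuousAt
  have c₂ : Continuous w₂ := continuous_iff_continuousAt.2 fun s => (h₂ s).continuousAt
  have hclopen : IsClopen {s | w₁ s = w₂ s} := by
    refine ⟨isClosed_eq c₁ c₂, isOpen_iff_mem_nhds.2 fun s hs => ?_⟩
    obtain ⟨K, t, ht, hK⟩ := (hV.contDiffAt (x := w₁ s)).exists_lipschitzOnWith
    have ht' : t ∈ 𝓝 (w₂ s) := by rwa [← show w₁ s = w₂ s from hs]
    exact ODE_solution_unique_of_eventually (v := fun _ => V) (s := fun _ => t)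
      (Eventually.of_forall fun _ => hK)
      ((c₁.continuousAt.eventually ht).mono fun u hu => ⟨h₁ u, hu⟩)
      ((c₂.continuousAt.eventually ht').mono fun u hu => ⟨h₂ u, hu⟩) hs
  funext s
  exact eq_univ_iff_forall.1 (hclopen.eq_univ ⟨s₀, h₀⟩) s

/-- A bounded Lipschitz vector field on a complete space has global integral curves. -/
lemma exists_global_solution [CompleteSpace E] {V : E → E} {K : NNReal} (hV : LipschitzWith K V)
    {C : ℝ} (hC : ∀ x, ‖V x‖ ≤ C) (x : E) :
    ∃ w : ℝ → E, w 0 = x ∧ ∀ s, HasDerivAt w (V (w s)) s := by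
  have hC0 : 0 ≤ C := (norm_nonneg _).trans (hC x)
  have hloc : ∀ T : ℝ, 0 < T → ∃ w : ℝ → E, w 0 = x ∧
      ∀ s ∈ Ioo (-T) T, HasDerivAt w (V (w s)) s := by
    intro T hT
    have hpl : IsPicardLindelof (fun _ => V) (tmin := -T) (tmax := T)
        ⟨0, by constructor <;> linarith⟩ x (⟨C, hC0⟩ * ⟨T, hT.le⟩) 0 ⟨C, hC0⟩ K :=
      { lipschitzOnWith := fun _ _ => hV.lipschitzOnWith
        continuousOn := fun _ _ => continuousOn_const
        norm_le := fun _ _ y _ => hC y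
        mul_max_le := by
          change C * max (T - 0) (0 - -T) ≤ C * T - 0
          simp }
    obtain ⟨w, hw0, hw⟩ := hpl.exists_eq_forall_mem_Icc_hasDerivWithinAt₀
    exact ⟨w, hw0, fun s hs =>
      (hw s (Ioo_subset_Icc_self hs)).hasDerivAt (Icc_mem_nhds hs.1 hs.2)⟩
  choose! α hα0 hα using hloc
  have hagree : ∀ S T : ℝ, 0 < S → S ≤ T → EqOn (α S) (α T) (Ioo (-S) S) := by
    intro S T hS hST
    refine ODE_solution_unique_of_mem_Ioo (v := fun _ => V) (s := fun _ => univ) (K := K)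
      (fun _ _ => hV.lipschitzOnWith) (t₀ := 0) ⟨by linarith, hS⟩
      (fun t ht => ⟨hα S hS t ht, mem_univ _⟩)
      (fun t ht => ⟨hα T (by linarith) t ⟨by linarith [ht.1], by linarith [ht.2]⟩, mem_univ _⟩)
      (by rw [hα0 S hS, hα0 T (by linarith)])
  refine ⟨fun t => α (|t| + 1) t, by simp [hα0], fun s => ?_⟩
  have hs1 := neg_abs_le s
  have hs2 := le_abs_self s
  have hev : (fun t => α (|t| + 1) t) =ᶠ[𝓝 s] α (|s| + 2) := by
    filter_upwards [Ioo_mem_nhds (show s - 1 < s by linarith) (show s < s + 1 by linarith)]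
      with t ht
    have : |t| ≤ |s| + 1 := abs_le.2 ⟨by linarith [ht.1], by linarith [ht.2]⟩
    have h1 := neg_abs_le t
    have h2 := le_abs_self t
    exact hagree _ _ (by positivity) (by linarith) ⟨by linarith, by linarith⟩
  have hd := (hα (|s| + 2) (by positivity) s ⟨by linarith, by linarith⟩).congr_of_eventuallyEq hev
  rwa [← hev.eq_of_nhds] at hd

/-- Two global solutions of an equation with Lipschitz right-hand side separate at most
exponentially. -/
lemma dist_le_mul_exp_of_lipschitz {V : E → E} {K : NNReal} (hV : LipschitzWith K V)
    {w₁ w₂ : ℝ → E} (h₁ : ∀ s, HasDerivAt w₁ (V (w₁ s)) s)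
    (h₂ : ∀ s, HasDerivAt w₂ (V (w₂ s)) s) {t : ℝ} (ht : 0 ≤ t) :
    dist (w₁ t) (w₂ t) ≤ dist (w₁ 0) (w₂ 0) * Real.exp (K * t) := by
  simpa using dist_le_of_trajectories_ODE (v := fun _ => V) (a := 0) (b := t)
    (fun _ => hV) (fun s _ => (h₁ s).continuousAt.continuousWithinAt)
    (fun s _ => (h₁ s).hasDerivWithinAt) (fun s _ => (h₂ s).continuousAt.continuousWithinAt)
    (fun s _ => (h₂ s).hasDerivWithinAt) le_rfl t (right_mem_Icc.2 ht)

end Autonomous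

section Cone

variable {E : Type*} [NormedAddCommGroup E] [InnerProductSpace ℝ E]

/-- The quadratic form `‖d‖² - q ⟪d, e⟫²`, whose nonpositive set is a double cone around `ℝ e`. -/
def coneForm (e : E) (q : ℝ) (d : E) : ℝ := ‖d‖ ^ 2 - q * ⟪d, e⟫ ^ 2

lemma continuous_coneForm (e : E) (q : ℝ) : Continuous (coneForm e q) := by
  unfold coneForm
  fun_prop

lemma HasDerivAt.coneForm {e : E} {q : ℝ} {d : ℝ → E} {v : E} {s : ℝ} (h : HasDerivAt d v s) :
    HasDerivAt (fun t => coneForm e q (d t)) (2 * (⟪d s, v⟫ - q * ⟪d s, e⟫ * ⟪v, e⟫)) s := by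
  have h1 := h.norm_sq
  have h2 : HasDerivAt (fun t => ⟪d t, e⟫) ⟪v, e⟫ s := by
    simpa using h.inner ℝ (hasDerivAt_const s e)
  have h3 := h1.sub ((h2.pow 2).const_mul q)
  refine h3.congr_deriv ?_
  simp
  ring

/-- Near the zero `ξ` of `F`, the flow of `-F` contracts transversally to `e` on the complement of a
cone around `ℝ e`, and inside this cone it moves in the direction of `e`, with quadratic speed. -/
structure IsConeField (F : E → E) (ξ e : E) (q c r : ℝ) : Prop where
  one_lt : 1 < q
  pos_speed : 0 < c
  pos_radius : 0 < r
  norm_eq : ‖e‖ = 1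
  map_zero : F ξ = 0
  contract : ∀ x y, ‖x - ξ‖ ≤ r → ‖y - ξ‖ ≤ r → 0 ≤ coneForm e q (x - y) →
    q * ⟪x - y, e⟫ * ⟪F x - F y, e⟫ ≤ ⟪x - y, F x - F y⟫
  speed : ∀ x, ‖x - ξ‖ ≤ r → coneForm e q (x - ξ) ≤ 0 → c * ⟪x - ξ, e⟫ ^ 2 ≤ -⟪F x, e⟫

namespace IsConeField

variable {F : E → E} {ξ e : E} {q c r : ℝ} {w w₁ w₂ : ℝ → E}

/-- The cone is forward invariant for differences of solutions. -/
lemma coneForm_sub_le (hF : IsConeField F ξ e q c r)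
    (h₁ : ∀ s, HasDerivAt w₁ (-F (w₁ s)) s) (h₂ : ∀ s, HasDerivAt w₂ (-F (w₂ s)) s)
    {a b m : ℝ} (hab : a ≤ b) (hm : 0 ≤ m) (ha : coneForm e q (w₁ a - w₂ a) ≤ m)
    (hw₁ : ∀ s ∈ Icc a b, ‖w₁ s - ξ‖ ≤ r) (hw₂ : ∀ s ∈ Icc a b, ‖w₂ s - ξ‖ ≤ r) :
    coneForm e q (w₁ b - w₂ b) ≤ m := by
  refine le_of_deriv_nonpos_above (f := fun s => coneForm e q (w₁ s - w₂ s)) hab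
    (fun s _ => ((h₁ s).sub (h₂ s)).coneForm) ha
    fun s hs hms => ?_
  have := hF.contract _ _ (hw₁ s hs) (hw₂ s hs) (hm.trans hms)
  have e1 : -F (w₁ s) - -F (w₂ s) = -(F (w₁ s) - F (w₂ s)) := by abel
  simp only [Pi.sub_apply]
  rw [e1, inner_neg_right, inner_neg_left]
  linarith

lemma coneForm_nonpos (hF : IsConeField F ξ e q c r)
    (h : ∀ s, HasDerivAt w (-F (w s)) s) {a b : ℝ} (hab : a ≤ b)
    (ha : coneForm e q (w a - ξ) ≤ 0) (hw : ∀ s ∈ Icc a b, ‖w s - ξ‖ ≤ r) :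
    coneForm e q (w b - ξ) ≤ 0 :=
  hF.coneForm_sub_le h (w₂ := fun _ => ξ)
    (fun s => by simpa [hF.map_zero] using hasDerivAt_const s ξ) hab le_rfl ha hw
    (fun _ _ => by simpa using hF.pos_radius.le)

/-- The difference of two solutions emanating from `ξ` lies in the cone. -/
lemma coneForm_sub_nonpos_of_tendsto (hF : IsConeField F ξ e q c r)
    (h₁ : ∀ s, HasDerivAt w₁ (-F (w₁ s)) s) (h₂ : ∀ s, HasDerivAt w₂ (-F (w₂ s)) s)
    (l₁ : Tendsto w₁ atBot (𝓝 ξ)) (l₂ : Tendsto w₂ atBot (𝓝 ξ)) {b : ℝ}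
    (hw₁ : ∀ s ≤ b, ‖w₁ s - ξ‖ ≤ r) (hw₂ : ∀ s ≤ b, ‖w₂ s - ξ‖ ≤ r) :
    coneForm e q (w₁ b - w₂ b) ≤ 0 := by
  refine le_of_forall_pos_le_add fun ε hε => ?_
  have hlim : Tendsto (fun s => coneForm e q (w₁ s - w₂ s)) atBot (𝓝 0) := by
    have := ((continuous_coneForm e q).tendsto (ξ - ξ)).comp (l₁.sub l₂)
    simpa [coneForm, Function.comp_def] using this
  obtain ⟨a, ha, hab⟩ := ((hlim.eventually (gt_mem_nhds hε)).and (eventually_le_atBot b)).exists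
  rw [zero_add]
  exact hF.coneForm_sub_le h₁ h₂ hab hε.le ha.le (fun s hs => hw₁ s hs.2) (fun s hs => hw₂ s hs.2)

lemma hasDerivAt_height (h : ∀ s, HasDerivAt w (-F (w s)) s) (s : ℝ) :
    HasDerivAt (fun t => ⟪w t - ξ, e⟫) (-⟪F (w s), e⟫) s := by
  simpa using ((h s).sub_const ξ).inner ℝ (hasDerivAt_const s e)

lemma monotoneOn_height (hF : IsConeField F ξ e q c r) (h : ∀ s, HasDerivAt w (-F (w s)) s)
    {D : Set ℝ} (hD : Convex ℝ D) (hw : ∀ s ∈ D, ‖w s - ξ‖ ≤ r)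
    (hcone : ∀ s ∈ D, coneForm e q (w s - ξ) ≤ 0) :
    MonotoneOn (fun t => ⟪w t - ξ, e⟫) D := by
  refine monotoneOn_of_deriv_nonneg hD
    (fun s _ => (hasDerivAt_height h s).continuousAt.continuousWithinAt)
    (fun s _ => (hasDerivAt_height h s).differentiableAt.differentiableWithinAt) fun s hs => ?_
  rw [(hasDerivAt_height h s).deriv]
  have hs := interior_subset hs
  have := hF.speed _ (hw s hs) (hcone s hs)
  have := hF.pos_speed
  have : 0 ≤ c * ⟪w s - ξ, e⟫ ^ 2 := by positivity
  linarith

lemma eq_zero_of_inner_eq_zero {d : E} (hd : coneForm e q d ≤ 0) (h0 : ⟪d, e⟫ = 0) : d = 0 := by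
  rw [coneForm, h0] at hd
  have : ‖d‖ ^ 2 = 0 := le_antisymm (by simpa using hd) (by positivity)
  simpa using this

/-- A nonconstant solution emanating from `ξ` leaves on the side of `e`. -/
lemma height_pos (hF : IsConeField F ξ e q c r) (hC : ContDiff ℝ 1 F)
    (h : ∀ s, HasDerivAt w (-F (w s)) s) (l : Tendsto w atBot (𝓝 ξ))
    (hne : ∃ s₁ s₂, w s₁ ≠ w s₂) {b : ℝ} (hw : ∀ s ≤ b, ‖w s - ξ‖ ≤ r) :
    0 < ⟪w b - ξ, e⟫ := by
  have hconst : ∀ s : ℝ, HasDerivAt (fun _ => ξ) (-F ξ) s := fun s => by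
    simpa [hF.map_zero] using hasDerivAt_const s ξ
  have hcone : ∀ s ≤ b, coneForm e q (w s - ξ) ≤ 0 := fun s hs =>
    hF.coneForm_sub_nonpos_of_tendsto h hconst l tendsto_const_nhds
      (fun t ht => hw t (ht.trans hs)) (fun _ _ => by simpa using hF.pos_radius.le)
  have hmono := hF.monotoneOn_height h (convex_Iic b) hw hcone
  have hlim : Tendsto (fun s => ⟪w s - ξ, e⟫) atBot (𝓝 0) := by
    simpa using (l.sub_const ξ).inner (tendsto_const_nhds (x := e))
  have hnn : 0 ≤ ⟪w b - ξ, e⟫ := le_of_tendsto hlim <| by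
    filter_upwards [eventually_le_atBot b] with s hs
    exact hmono hs self_mem_Iic hs
  refine lt_of_le_of_ne hnn fun h0 => ?_
  have hb : w b = ξ := sub_eq_zero.1 (eq_zero_of_inner_eq_zero (hcone b le_rfl) h0.symm)
  have := eq_of_hasDerivAt_of_contDiff hC.neg h hconst hb
  obtain ⟨s₁, s₂, hs⟩ := hne
  exact hs (by rw [this])

/-- Nonconstant solutions emanating from `ξ` are unique up to translation of time. -/
lemma eq_translate (hF : IsConeField F ξ e q c r) (hC : ContDiff ℝ 1 F)
    (h₁ : ∀ s, HasDerivAt w₁ (-F (w₁ s)) s) (l₁ : Tendsto w₁ atBot (𝓝 ξ))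
    (n₁ : ∃ s₁ s₂, w₁ s₁ ≠ w₁ s₂)
    (h₂ : ∀ s, HasDerivAt w₂ (-F (w₂ s)) s) (l₂ : Tendsto w₂ atBot (𝓝 ξ))
    (n₂ : ∃ s₁ s₂, w₂ s₁ ≠ w₂ s₂) :
    ∃ a : ℝ, ∀ s, w₂ s = w₁ (s + a) := by
  have hev : ∀ w : ℝ → E, Tendsto w atBot (𝓝 ξ) → ∃ T, ∀ s ≤ T, ‖w s - ξ‖ ≤ r := by
    intro w l
    obtain ⟨T, hT⟩ := eventually_atBot.1
      (l.eventually (Metric.closedBall_mem_nhds ξ hF.pos_radius))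
    exact ⟨T, fun s hs => by simpa [dist_eq_norm] using hT s hs⟩
  have hivt : ∀ w : ℝ → E, (∀ s, HasDerivAt w (-F (w s)) s) → Tendsto w atBot (𝓝 ξ) →
      ∀ T m, 0 < m → m ≤ ⟪w T - ξ, e⟫ → ∃ s ≤ T, ⟪w s - ξ, e⟫ = m := by
    intro w h l T m hm hmT
    have hlim : Tendsto (fun s => ⟪w s - ξ, e⟫) atBot (𝓝 0) := by
      simpa using (l.sub_const ξ).inner (tendsto_const_nhds (x := e))
    obtain ⟨a, ha, haT⟩ := ((hlim.eventually (gt_mem_nhds hm)).and (eventually_le_atBot T)).exists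
    obtain ⟨s, hs, hsm⟩ := intermediate_value_Icc haT
      (fun s _ => (hasDerivAt_height (ξ := ξ) (e := e) h s).continuousAt.continuousWithinAt)
      ⟨ha.le, hmT⟩
    exact ⟨s, hs.2, hsm⟩
  obtain ⟨T₁, hT₁⟩ := hev w₁ l₁
  obtain ⟨T₂, hT₂⟩ := hev w₂ l₂
  have hm : 0 < min ⟪w₁ T₁ - ξ, e⟫ ⟪w₂ T₂ - ξ, e⟫ :=
    lt_min (hF.height_pos hC h₁ l₁ n₁ hT₁) (hF.height_pos hC h₂ l₂ n₂ hT₂)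
  obtain ⟨t₁, ht₁, hm₁⟩ := hivt w₁ h₁ l₁ T₁ _ hm (min_le_left _ _)
  obtain ⟨t₂, ht₂, hm₂⟩ := hivt w₂ h₂ l₂ T₂ _ hm (min_le_right _ _)
  have h₁' : ∀ s, HasDerivAt (fun t => w₁ (t + (t₁ - t₂))) (-F (w₁ (s + (t₁ - t₂)))) s :=
    fun s => (h₁ _).comp_add_const s (t₁ - t₂)
  refine ⟨t₁ - t₂, fun s => ?_⟩
  have hcone := hF.coneForm_sub_nonpos_of_tendsto h₂ h₁' l₂
    (l₁.comp (tendsto_atBot_add_const_right _ _ tendsto_id)) (b := t₂)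
    (fun s hs => hT₂ s (hs.trans ht₂)) (fun s hs => hT₁ _ (by linarith))
  have hmeet : w₂ t₂ - w₁ (t₂ + (t₁ - t₂)) = 0 := by
    refine eq_zero_of_inner_eq_zero hcone ?_
    rw [add_sub_cancel, ← sub_sub_sub_cancel_right _ _ ξ, inner_sub_left, hm₁, hm₂, sub_self]
  exact congrFun (eq_of_hasDerivAt_of_contDiff hC.neg h₂ h₁' (sub_eq_zero.1 hmeet)) s

/-- Solutions starting on the axis of the cone close to `ξ` exit the ball of radius `r`, and stay
in the cone until then. -/
lemma exists_exit (hF : IsConeField F ξ e q c r) (h : ∀ s, HasDerivAt w (-F (w s)) s)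
    {ε : ℝ} (hε : 0 < ε) (hεr : ε < r) (h0 : w 0 = ξ + ε • e) :
    ∃ T, 0 ≤ T ∧ ‖w T - ξ‖ = r ∧ ∀ s ∈ Icc 0 T, ‖w s - ξ‖ ≤ r ∧
      coneForm e q (w s - ξ) ≤ 0 ∧ 0 ≤ ⟪w s - ξ, e⟫ := by
  have hcw : Continuous fun s => ‖w s - ξ‖ :=
    ((continuous_iff_continuousAt.2 fun s => (h s).continuousAt).sub continuous_const).norm
  have hn0 : ‖w 0 - ξ‖ = ε := by
    rw [h0, add_sub_cancel_left, norm_smul, hF.norm_eq, mul_one, Real.norm_of_nonneg hε.le]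
  have hu0 : ⟪w 0 - ξ, e⟫ = ε := by
    rw [h0, add_sub_cancel_left, inner_smul_left, real_inner_self_eq_norm_sq, hF.norm_eq]
    simp
  have hc0 : coneForm e q (w 0 - ξ) ≤ 0 := by
    rw [coneForm, hn0, hu0]
    nlinarith [hF.one_lt, sq_nonneg ε]
  have hstay : ∀ T, (∀ s ∈ Icc 0 T, ‖w s - ξ‖ ≤ r) → ∀ s ∈ Icc 0 T,
      coneForm e q (w s - ξ) ≤ 0 ∧ ε ≤ ⟪w s - ξ, e⟫ := by
    intro T hT
    have hcone : ∀ s ∈ Icc 0 T, coneForm e q (w s - ξ) ≤ 0 := fun s hs =>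
      hF.coneForm_nonpos h hs.1 hc0 fun t ht => hT t ⟨ht.1, ht.2.trans hs.2⟩
    refine fun s hs => ⟨hcone s hs, ?_⟩
    have := hF.monotoneOn_height h (convex_Icc 0 T) hT hcone
      (left_mem_Icc.2 (hs.1.trans hs.2)) hs hs.1
    simpa only [hu0] using this
  have hexit : ∃ t, 0 ≤ t ∧ r < ‖w t - ξ‖ := by
    by_contra! hcon
    have hcpos := hF.pos_speed
    set T := (r + 1) / (c * ε ^ 2) with hTdef
    have hT0 : 0 ≤ T := by have := hF.pos_radius; positivity
    have hin := hstay T fun s hs => hcon s hs.1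
    have hgrow : ε + c * ε ^ 2 * T - ⟪w T - ξ, e⟫ ≤ 0 := by
      refine le_of_deriv_nonpos_above (f := fun s => ε + c * ε ^ 2 * s - ⟪w s - ξ, e⟫) hT0
        (fun s _ => (((hasDerivAt_id s).const_mul (c * ε ^ 2)).const_add ε).sub
          (hasDerivAt_height h s)) (by simp [hu0]) fun s hs _ => ?_
      have h1 := hF.speed _ (hcon s hs.1) (hin s hs).1
      have h2 : c * ε ^ 2 ≤ c * ⟪w s - ξ, e⟫ ^ 2 := by
        have := (hin s hs).2
        gcongr
      linarith
    have hle : ⟪w T - ξ, e⟫ ≤ r := by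
      have := real_inner_le_norm (w T - ξ) e
      rw [hF.norm_eq, mul_one] at this
      exact this.trans (hcon T hT0)
    have : c * ε ^ 2 * T = r + 1 := by
      rw [hTdef]
      field_simp
    linarith
  obtain ⟨t, ht0, ht⟩ := hexit
  set S := {s : ℝ | 0 ≤ s ∧ r ≤ ‖w s - ξ‖} with hS
  have hSc : IsClosed S :=
    (isClosed_le continuous_const continuous_id).inter (isClosed_le continuous_const hcw)
  have hSb : BddBelow S := ⟨0, fun s hs => hs.1⟩
  have hSm : sInf S ∈ S := hSc.csInf_mem ⟨t, ht0, ht.le⟩ hSb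
  have hTr : ‖w (sInf S) - ξ‖ = r := by
    obtain ⟨s, hs, hsr⟩ := intermediate_value_Icc hSm.1 hcw.continuousOn
      (show r ∈ Icc _ _ from ⟨by linarith, hSm.2⟩)
    have : s = sInf S := le_antisymm hs.2 (csInf_le hSb ⟨hs.1, hsr.ge⟩)
    rw [← this]
    exact hsr
  have hball : ∀ s ∈ Icc 0 (sInf S), ‖w s - ξ‖ ≤ r := by
    intro s hs
    rcases hs.2.eq_or_lt with heq | hlt
    · rw [heq, hTr]
    · by_contra! hcon
      exact (csInf_le hSb ⟨hs.1, hcon.le⟩).not_gt hlt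
  refine ⟨sInf S, hSm.1, hTr, fun s hs => ⟨hball s hs, (hstay _ hball s hs).1, ?_⟩⟩
  exact hε.le.trans (hstay _ hball s hs).2

/-- A solution that stays in the cone for all negative times emanates from `ξ`. -/
lemma tendsto_of_forall_mem_cone (hF : IsConeField F ξ e q c r)
    (h : ∀ s, HasDerivAt w (-F (w s)) s) (hw : ∀ s ≤ 0, ‖w s - ξ‖ ≤ r)
    (hcone : ∀ s ≤ 0, coneForm e q (w s - ξ) ≤ 0) (hu : ∀ s ≤ 0, 0 ≤ ⟪w s - ξ, e⟫) :
    Tendsto w atBot (𝓝 ξ) := by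
  have hq := hF.one_lt
  have hmono := hF.monotoneOn_height h (convex_Iic 0) hw hcone
  have hsmall : ∀ η > 0, ∃ s ≤ 0, ⟪w s - ξ, e⟫ < η := by
    intro η hη
    by_contra! hcon
    have hcpos := hF.pos_speed
    set T := (r + 1) / (c * η ^ 2) with hTdef
    have hT0 : 0 ≤ T := by have := hF.pos_radius; positivity
    have hgrow : c * η ^ 2 * 0 - ⟪w 0 - ξ, e⟫ ≤ c * η ^ 2 * (-T) := by
      refine le_of_deriv_nonpos_above (f := fun s => c * η ^ 2 * s - ⟪w s - ξ, e⟫)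
        (neg_nonpos.2 hT0) (fun s _ => ((hasDerivAt_id s).const_mul (c * η ^ 2)).sub
          (hasDerivAt_height h s)) ?_ fun s hs _ => ?_
      · have := hu (-T) (by linarith)
        linarith
      · have h1 := hF.speed _ (hw s hs.2) (hcone s hs.2)
        have h2 : c * η ^ 2 ≤ c * ⟪w s - ξ, e⟫ ^ 2 := by
          have := hcon s hs.2
          gcongr
        linarith
    have hle : ⟪w 0 - ξ, e⟫ ≤ r := by
      have := real_inner_le_norm (w 0 - ξ) e
      rw [hF.norm_eq, mul_one] at this
      exact this.trans (hw 0 le_rfl)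
    have : c * η ^ 2 * T = r + 1 := by
      rw [hTdef]
      field_simp
    linarith
  rw [tendsto_iff_norm_sub_tendsto_zero, Metric.tendsto_nhds]
  intro ε hε
  have hη : 0 < ε / q := by positivity
  obtain ⟨s₀, hs₀, hlt⟩ := hsmall _ hη
  filter_upwards [eventually_le_atBot s₀] with s hs
  have hs0 : s ≤ 0 := hs.trans hs₀
  have h1 : ⟪w s - ξ, e⟫ < ε / q := (hmono hs0 hs₀ hs).trans_lt hlt
  have h2 := hcone s hs0
  have h3 := hu s hs0
  rw [coneForm] at h2
  rw [dist_zero_right, norm_norm]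
  refine lt_of_pow_lt_pow_left₀ 2 hε.le ?_
  have h4 : q * ⟪w s - ξ, e⟫ < ε := by
    rw [lt_div_iff₀ (by linarith)] at h1
    linarith
  have h5 : (q * ⟪w s - ξ, e⟫) ^ 2 < ε ^ 2 := by gcongr
  have h6 : 0 ≤ (q - 1) * (q * ⟪w s - ξ, e⟫ ^ 2) :=
    mul_nonneg (by linarith) (by positivity)
  linarith

/-- Existence of a solution emanating from `ξ`, for a field of compact support. -/
lemma exists_solution_of_hasCompactSupport [FiniteDimensional ℝ E]
    (hF : IsConeField F ξ e q c r) (hC : ContDiff ℝ 1 F) (hsupp : HasCompactSupport F) :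
    ∃ w : ℝ → E, (∀ s, HasDerivAt w (-F (w s)) s) ∧ Tendsto w atBot (𝓝 ξ) ∧
      (∀ s ≤ 0, ‖w s - ξ‖ ≤ r) ∧ ‖w 0 - ξ‖ = r := by
  have : CompleteSpace E := FiniteDimensional.complete ℝ E
  have hr := hF.pos_radius
  obtain ⟨K, hK⟩ := hC.lipschitzWith_of_hasCompactSupport hsupp one_ne_zero
  obtain ⟨C, hCb⟩ := hsupp.exists_bound_of_continuous hC.continuous
  have hKn : LipschitzWith K (fun x => -F x) := hK.neg
  choose φ hφ0 hφ using exists_global_solution hKn (C := C) (by simpa using hCb)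
  let ε : ℕ → ℝ := fun k => r / (k + 2)
  have hε : ∀ k, 0 < ε k := fun k => by positivity
  have hεr : ∀ k, ε k < r := fun k => by
    refine div_lt_self hr ?_
    have : (0 : ℝ) ≤ k := k.cast_nonneg
    linarith
  choose T hT0 hTr hT using fun k =>
    hF.exists_exit (hφ (ξ + ε k • e)) (hε k) (hεr k) (hφ0 _)
  have hTlarge : ∀ k : ℕ, (k : ℝ) + 2 ≤ Real.exp (K * T k) := by
    intro k
    have := dist_le_mul_exp_of_lipschitz hKn (hφ (ξ + ε k • e)) (w₂ := fun _ => ξ)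
      (fun s => by simpa [hF.map_zero] using hasDerivAt_const s ξ) (hT0 k)
    rw [dist_eq_norm, hTr, hφ0, dist_eq_norm, add_sub_cancel_left, norm_smul, hF.norm_eq, mul_one,
      Real.norm_of_nonneg (hε k).le, div_mul_eq_mul_div, le_div_iff₀ (by positivity)] at this
    exact le_of_mul_le_mul_left this hr
  have hTev : ∀ s : ℝ, ∀ᶠ k in atTop, s ≤ T k := by
    intro s
    filter_upwards [(tendsto_natCast_atTop_atTop (R := ℝ)).eventually_ge_atTop
      (Real.exp (K * s))] with k hk
    by_contra! hlt
    have : Real.exp (K * T k) ≤ Real.exp (K * s) := by gcongr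
    linarith [hTlarge k]
  obtain ⟨p, hp, σ, hσ, hlim⟩ := (isCompact_sphere ξ r).tendsto_subseq
    (x := fun k => φ (ξ + ε k • e) (T k)) (fun k => by simp [hTr])
  have hback : ∀ s ≤ 0, Tendsto (fun k => φ (ξ + ε (σ k) • e) (T (σ k) + s)) atTop
      (𝓝 (φ p s)) := by
    intro s hs
    have hrev : ∀ (x : E) (a t : ℝ), HasDerivAt (fun t => φ x (a - t)) (F (φ x (a - t))) t := by
      intro x a t
      simpa using (hφ x (a - t)).comp_const_sub a t
    have hb : ∀ k, dist (φ (ξ + ε (σ k) • e) (T (σ k) + s)) (φ p s) ≤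
        dist (φ (ξ + ε (σ k) • e) (T (σ k))) p * Real.exp (K * -s) := by
      intro k
      simpa [hφ0] using dist_le_mul_exp_of_lipschitz hK (hrev (ξ + ε (σ k) • e) (T (σ k)))
        (hrev p 0) (neg_nonneg.2 hs)
    rw [tendsto_iff_dist_tendsto_zero]
    refine squeeze_zero (fun _ => dist_nonneg) hb ?_
    simpa using (tendsto_iff_dist_tendsto_zero.1 hlim).mul_const (Real.exp (K * -s))
  have hmem : ∀ s ≤ 0, φ p s ∈
      {x | ‖x - ξ‖ ≤ r ∧ coneForm e q (x - ξ) ≤ 0 ∧ 0 ≤ ⟪x - ξ, e⟫} := by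
    intro s hs
    have hcl : IsClosed {x | ‖x - ξ‖ ≤ r ∧ coneForm e q (x - ξ) ≤ 0 ∧ 0 ≤ ⟪x - ξ, e⟫} := by
      have hsub : Continuous fun x : E => x - ξ := by fun_prop
      have hin : Continuous fun x : E => ⟪x - ξ, e⟫ := hsub.inner continuous_const
      exact (isClosed_le hsub.norm continuous_const).inter
        ((isClosed_le ((continuous_coneForm e q).comp hsub) continuous_const).inter
          (isClosed_le continuous_const hin))
    refine hcl.mem_of_tendsto (hback s hs) ?_
    filter_upwards [hσ.tendsto_atTop.eventually (hTev (-s))] with k hk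
    exact hT (σ k) _ ⟨by linarith, by linarith⟩
  refine ⟨φ p, hφ p, hF.tendsto_of_forall_mem_cone (hφ p) (fun s hs => (hmem s hs).1)
    (fun s hs => (hmem s hs).2.1) (fun s hs => (hmem s hs).2.2), fun s hs => (hmem s hs).1, ?_⟩
  rw [hφ0]
  simpa [dist_eq_norm] using hp

/-- Existence of a solution emanating from `ξ`, for a coercive field. -/
lemma exists_solution_of_coercive [FiniteDimensional ℝ E]
    (hF : IsConeField F ξ e q c r) (hC : ContDiff ℝ 1 F) {a₀ c₀ : ℝ} (hc₀ : 0 < c₀)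
    (hcoer : ∀ x, c₀ * ‖x‖ ^ 2 - a₀ ≤ ⟪F x, x⟫) :
    ∃ w : ℝ → E, (∀ s, HasDerivAt w (-F (w s)) s) ∧ Tendsto w atBot (𝓝 ξ) ∧
      ∃ s₁ s₂, w s₁ ≠ w s₂ := by
  have hr := hF.pos_radius
  set R : ℝ := ‖ξ‖ + r + |a₀| / c₀ + 1 with hR
  have hξ := norm_nonneg ξ
  have hdiv : 0 ≤ |a₀| / c₀ := by positivity
  have hR0 : 0 < R := by positivity
  have hRa : a₀ ≤ c₀ * R ^ 2 := by
    have h1 : |a₀| / c₀ ≤ R ^ 2 := by nlinarith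
    rw [div_le_iff₀ hc₀] at h1
    linarith [le_abs_self a₀]
  let χ : ContDiffBump (0 : E) := ⟨R, R + 1, hR0, by linarith⟩
  have hχ1 : ∀ x : E, ‖x‖ ≤ R → χ x = 1 := fun x hx =>
    χ.one_of_mem_closedBall (by simpa using hx)
  have hball : ∀ x : E, ‖x - ξ‖ ≤ r → ‖x‖ ≤ R := fun x hx => by
    have := norm_le_norm_add_norm_sub' x ξ
    linarith
  let G : E → E := fun x => χ x • F x
  have hGF : ∀ x : E, ‖x‖ ≤ R → G x = F x := fun x hx => by simp [G, hχ1 x hx]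
  have hGcone : IsConeField G ξ e q c r :=
    { one_lt := hF.one_lt
      pos_speed := hF.pos_speed
      pos_radius := hr
      norm_eq := hF.norm_eq
      map_zero := by simp [G, hF.map_zero]
      contract := fun x y hx hy => by
        rw [hGF x (hball x hx), hGF y (hball y hy)]
        exact hF.contract x y hx hy
      speed := fun x hx => by
        rw [hGF x (hball x hx)]
        exact hF.speed x hx }
  obtain ⟨w, hw, hlim, hneg, h0⟩ := hGcone.exists_solution_of_hasCompactSupport
    (χ.contDiff.smul hC) χ.hasCompactSupport.smul_right
  have hwR : ∀ s, ‖w s‖ ≤ R := by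
    intro s
    rcases le_total s 0 with hs | hs
    · exact hball _ (hneg s hs)
    · refine le_of_sq_le_sq ?_ hR0.le
      refine le_of_deriv_nonpos_above (f := fun s => ‖w s‖ ^ 2) hs
        (fun t _ => (hw t).norm_sq) ?_ fun t _ ht => ?_
      · have := hball _ (hneg 0 le_rfl)
        gcongr
      · have h1 := hcoer (w t)
        have h2 : 0 ≤ ⟪F (w t), w t⟫ := by nlinarith
        have h3 : 0 ≤ χ (w t) := χ.nonneg
        rw [inner_neg_right, real_inner_comm, inner_smul_left]
        have : 0 ≤ χ (w t) * ⟪F (w t), w t⟫ := mul_nonneg h3 h2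
        simpa using this
  refine ⟨w, fun s => by simpa only [hGF _ (hwR s)] using hw s, hlim, ?_⟩
  by_contra! hconst
  have hw0 : w = fun _ => w 0 := funext fun s => hconst s 0
  rw [hw0] at hlim
  rw [tendsto_nhds_unique tendsto_const_nhds hlim] at h0
  simp at h0
  linarith

end IsConeField

end Cone

section Gradient

variable {E : Type*} [NormedAddCommGroup E] [InnerProductSpace ℝ E]

/-- A positive semidefinite symmetric operator is coercive on the orthogonal complement of `e` if
its kernel is spanned by `e`. -/
lemma exists_coercive_of_ker_eq_span [FiniteDimensional ℝ E] {A : E →L[ℝ] E}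
    (hsymm : ∀ x y, ⟪A x, y⟫ = ⟪x, A y⟫) (hpsd : ∀ x, 0 ≤ ⟪A x, x⟫) {e : E}
    (hker : LinearMap.ker A.toLinearMap = Submodule.span ℝ {e}) :
    ∃ μ > 0, ∀ z, ⟪z, e⟫ = 0 → μ * ‖z‖ ^ 2 ≤ ⟪A z, z⟫ := by
  have hzero : ∀ z, ⟪A z, z⟫ = 0 → A z = 0 := by
    intro z hz
    set a := ⟪A z, A z⟫ with ha
    set b := ⟪A (A z), A z⟫ with hb
    have ha0 : 0 ≤ a := real_inner_self_nonneg
    have hb0 : 0 ≤ b := hpsd _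
    have hquad : ∀ t : ℝ, 0 ≤ 2 * t * a + t ^ 2 * b := by
      intro t
      have h1 := hpsd (z + t • A z)
      have h2 : ⟪A (A z), z⟫ = a := by rw [hsymm]
      simp only [map_add, map_smul, inner_add_left, inner_add_right, inner_smul_left,
        inner_smul_right, hz, h2, ← ha, ← hb, conj_trivial] at h1
      linarith
    have hdisc := discrim_le_zero (a := b) (b := 2 * a) (c := 0) fun t => by
      have := hquad t
      linarith
    rw [discrim] at hdisc
    have : a = 0 := by nlinarith
    exact inner_self_eq_zero.1 this
  set S := {z : E | ‖z‖ = 1 ∧ ⟪z, e⟫ = 0} with hS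
  have hSc : IsCompact S := by
    have hcl : IsClosed {z : E | ⟪z, e⟫ = 0} := isClosed_eq (by fun_prop) continuous_const
    have : S = Metric.sphere 0 1 ∩ {z : E | ⟪z, e⟫ = 0} := by ext; simp [hS]
    rw [this]
    exact (isCompact_sphere _ _).inter_right hcl
  have hmin : ∃ μ > 0, ∀ z ∈ S, μ ≤ ⟪A z, z⟫ := by
    rcases S.eq_empty_or_nonempty with hemp | hne
    · exact ⟨1, one_pos, by simp [hemp]⟩
    · obtain ⟨z, hz, hzmin⟩ := hSc.exists_isMinOn hne (f := fun z => ⟪A z, z⟫)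
        (by fun_prop)
      refine ⟨⟪A z, z⟫, lt_of_le_of_ne (hpsd z) fun h0 => ?_, hzmin⟩
      have hmem : z ∈ Submodule.span ℝ {e} := by
        rw [← hker]
        exact hzero z h0.symm
      obtain ⟨a, rfl⟩ := Submodule.mem_span_singleton.1 hmem
      have h1 : ⟪a • e, a • e⟫ = 0 := by rw [inner_smul_right, hz.2, mul_zero]
      have h2 := hz.1
      rw [inner_self_eq_zero.1 h1] at h2
      simp at h2
  obtain ⟨μ, hμ, hμS⟩ := hmin
  refine ⟨μ, hμ, fun z hz => ?_⟩
  rcases eq_or_ne z 0 with rfl | hz0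
  · simp
  · have hn : 0 < ‖z‖ := norm_pos_iff.2 hz0
    have := hμS (‖z‖⁻¹ • z) ⟨by rw [norm_smul, norm_inv, norm_norm, inv_mul_cancel₀ hn.ne'],
      by rw [inner_smul_left, hz, mul_zero]⟩
    rw [map_smul, inner_smul_left, inner_smul_right, conj_trivial] at this
    calc μ * ‖z‖ ^ 2 ≤ ‖z‖⁻¹ * (‖z‖⁻¹ * ⟪A z, z⟫) * ‖z‖ ^ 2 := by gcongr
      _ = ⟪A z, z⟫ := by field_simp

/-- Second order Taylor expansion of a `C²` function at a critical zero. -/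
lemma exists_abs_sub_half_le {f : E → ℝ} (hf : ContDiff ℝ 2 f) {ξ : E} (h0 : f ξ = 0)
    (h1 : fderiv ℝ f ξ = 0) {ε : ℝ} (hε : 0 < ε) :
    ∃ r > 0, ∀ v, ‖v‖ < r →
      |f (ξ + v) - fderiv ℝ (fderiv ℝ f) ξ v v / 2| ≤ ε * ‖v‖ ^ 2 := by
  set B := fderiv ℝ (fderiv ℝ f) ξ with hB
  have hdf : Differentiable ℝ f := hf.differentiable (by norm_num)
  have hBd : HasFDerivAt (fderiv ℝ f) B ξ :=
    ((hf.fderiv_right (m := 1) (by norm_num)).differentiable (by norm_num) ξ).hasFDerivAt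
  have hlo := hBd.isLittleO.def hε
  obtain ⟨r, hr, hball⟩ := Metric.eventually_nhds_iff.1 hlo
  refine ⟨r, hr, fun v hv => ?_⟩
  have hder : ∀ t : ℝ, HasDerivAt (fun t : ℝ => f (ξ + t • v) - t ^ 2 * (B v v / 2))
      (fderiv ℝ f (ξ + t • v) v - 2 * t * (B v v / 2)) t := by
    intro t
    have hline : HasDerivAt (fun t : ℝ => ξ + t • v) v t := by
      simpa using ((hasDerivAt_id t).smul_const v).const_add ξ
    have h2 := (hdf (ξ + t • v)).hasFDerivAt.comp_hasDerivAt t hline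
    have h3 := (hasDerivAt_pow 2 t).mul_const (B v v / 2)
    refine (h2.sub h3).congr_deriv ?_
    simp
  have hbound : ∀ t ∈ Ico (0 : ℝ) 1,
      ‖fderiv ℝ f (ξ + t • v) v - 2 * t * (B v v / 2)‖ ≤ ε * ‖v‖ ^ 2 := by
    intro t ht
    have hn : ‖t • v‖ ≤ ‖v‖ := by
      rw [norm_smul, Real.norm_of_nonneg ht.1]
      exact mul_le_of_le_one_left (norm_nonneg v) ht.2.le
    have h4 := hball (y := ξ + t • v) (by simpa [dist_eq_norm] using hn.trans_lt hv)
    rw [h1, sub_zero, add_sub_cancel_left] at h4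
    have h5 : fderiv ℝ f (ξ + t • v) v - 2 * t * (B v v / 2) =
        (fderiv ℝ f (ξ + t • v) - B (t • v)) v := by
      simp
      ring
    rw [h5]
    calc _ ≤ ‖fderiv ℝ f (ξ + t • v) - B (t • v)‖ * ‖v‖ := ContinuousLinearMap.le_opNorm _ _
      _ ≤ (ε * ‖v‖) * ‖v‖ := by
        gcongr
        exact h4.trans (by gcongr)
      _ = _ := by ring
  have := norm_image_sub_le_of_norm_deriv_le_segment_01'
    (fun t _ => (hder t).hasDerivWithinAt) hbound
  simpa [h0] using this

/-- On a thin cone around `e`, a bilinear form is controlled by its value at `(e, e)`. -/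
lemma bilin_le_of_coneForm_nonpos (B : E →L[ℝ] E →L[ℝ] ℝ) {e v : E} (he : ‖e‖ = 1) {κ : ℝ}
    (hκ0 : 0 ≤ κ) (hκ1 : κ ≤ 1) (hv : coneForm e (1 + κ ^ 2) v ≤ 0) :
    B v v ≤ (B e e + 3 * κ * ‖B‖) * ⟪v, e⟫ ^ 2 := by
  set u := ⟪v, e⟫ with hu
  set y := v - u • e with hy
  have hyn : ‖y‖ ≤ κ * |u| := by
    refine le_of_sq_le_sq ?_ (by positivity)
    have : ‖y‖ ^ 2 = ‖v‖ ^ 2 - u ^ 2 := by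
      rw [hy, norm_sub_sq_real, inner_smul_right, norm_smul, he, ← hu, mul_one,
        Real.norm_eq_abs, sq_abs]
      ring
    rw [coneForm, ← hu] at hv
    rw [this, mul_pow, sq_abs]
    linarith
  have hv' : v = u • e + y := by rw [hy]; abel
  have hB : ∀ x z, B x z ≤ ‖B‖ * ‖x‖ * ‖z‖ := fun x z =>
    (le_abs_self _).trans (B.le_opNorm₂ x z)
  have hue : ‖u • e‖ = |u| := by rw [norm_smul, he, mul_one, Real.norm_eq_abs]
  have hBn := norm_nonneg B
  have h1 : B (u • e) y ≤ ‖B‖ * |u| * (κ * |u|) :=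
    (hB _ _).trans (by rw [hue]; gcongr)
  have h2 : B y (u • e) ≤ ‖B‖ * (κ * |u|) * |u| :=
    (hB _ _).trans (by rw [hue]; gcongr)
  have h3 : B y y ≤ ‖B‖ * (κ * |u|) * (1 * |u|) :=
    (hB _ _).trans (by gcongr; exact hyn.trans (by gcongr))
  have h4 : B v v = u ^ 2 * B e e + B (u • e) y + B y (u • e) + B y y := by
    rw [hv']
    simp only [map_add, map_smul, add_apply, smul_apply, smul_eq_mul]
    ring
  have h5 := sq_abs u
  rw [h4, ← h5]
  linarith

/-- A `C²` field with symmetric positive semidefinite derivative of one-dimensional kernel and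
nondegenerate second order term is a cone field. -/
lemma exists_isConeField [FiniteDimensional ℝ E] {F : E → E} (hC : ContDiff ℝ 2 F) {ξ e : E}
    (he : ‖e‖ = 1) (h0 : F ξ = 0)
    (hsymm : ∀ x y, ⟪fderiv ℝ F ξ x, y⟫ = ⟪x, fderiv ℝ F ξ y⟫)
    (hpsd : ∀ x, 0 ≤ ⟪fderiv ℝ F ξ x, x⟫)
    (hker : LinearMap.ker (fderiv ℝ F ξ).toLinearMap = Submodule.span ℝ {e})
    (hneg : fderiv ℝ (fderiv ℝ fun x => ⟪F x, e⟫) ξ e e < 0) :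
    ∃ q c r, IsConeField F ξ e q c r := by
  set A := fderiv ℝ F ξ with hA
  set f : E → ℝ := fun x => ⟪F x, e⟫ with hf
  set B := fderiv ℝ (fderiv ℝ f) ξ with hB
  set b := -B e e with hb
  have hbpos : 0 < b := neg_pos.2 hneg
  have hAe : A e = 0 := by
    have : e ∈ LinearMap.ker A.toLinearMap := hker ▸ Submodule.mem_span_singleton_self e
    simpa using this
  obtain ⟨μ, hμ, hcoer⟩ := exists_coercive_of_ker_eq_span hsymm hpsd hker
  have hBn := norm_nonneg B
  obtain ⟨κ, hκ0, hκ1, hκB⟩ : ∃ κ : ℝ, 0 < κ ∧ κ ≤ 1 ∧ 3 * κ * ‖B‖ ≤ b / 4 := by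
    refine ⟨min 1 (b / (12 * (‖B‖ + 1))), by positivity, min_le_left _ _, ?_⟩
    have h1 : min 1 (b / (12 * (‖B‖ + 1))) * (12 * (‖B‖ + 1)) ≤ b := by
      rw [← le_div_iff₀ (by positivity)]
      exact min_le_right _ _
    have h2 : 0 < min 1 (b / (12 * (‖B‖ + 1))) := by positivity
    linarith
  have hκsq : κ ^ 2 ≤ 1 := by nlinarith
  have hκsq0 : 0 < κ ^ 2 := by positivity
  set q := 1 + κ ^ 2 with hq
  set δ := μ * κ ^ 2 / 6 with hδ
  have hδpos : 0 < δ := by positivity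
  have hFd : HasStrictFDerivAt F A ξ :=
    hC.contDiffAt.hasStrictFDerivAt (by norm_num)
  have hstrict : ∃ r > 0, ∀ x y, ‖x - ξ‖ < r → ‖y - ξ‖ < r →
      ‖F x - F y - A (x - y)‖ ≤ δ * ‖x - y‖ := by
    have := hFd.isLittleO.def hδpos
    obtain ⟨r, hr, hball⟩ := Metric.eventually_nhds_iff.1 this
    refine ⟨r, hr, fun x y hx hy => hball (y := (x, y)) ?_⟩
    simpa [Prod.dist_eq, dist_eq_norm] using ⟨hx, hy⟩
  have hfC : ContDiff ℝ 2 f := hC.inner ℝ contDiff_const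
  have hfd : fderiv ℝ f ξ = 0 := by
    ext v
    rw [hf, fderiv_inner_apply ℝ hFd.hasFDerivAt.differentiableAt (differentiableAt_const e)]
    simp [← hA, hsymm, hAe]
  obtain ⟨r₁, hr₁, hlin⟩ := hstrict
  obtain ⟨r₂, hr₂, htaylor⟩ := exists_abs_sub_half_le hfC (ξ := ξ) (by simp [hf, h0]) hfd
    (show 0 < b / 16 by positivity)
  have hrr : 0 < min r₁ r₂ := lt_min hr₁ hr₂
  have hlt₁ : min r₁ r₂ / 2 < r₁ := (half_lt_self hrr).trans_le (min_le_left _ _)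
  have hlt₂ : min r₁ r₂ / 2 < r₂ := (half_lt_self hrr).trans_le (min_le_right _ _)
  refine ⟨q, b / 4, min r₁ r₂ / 2,
    { one_lt := by linarith
      pos_speed := by positivity
      pos_radius := by positivity
      norm_eq := he
      map_zero := h0
      contract := fun x y hx hy hxy => ?_
      speed := fun x hx hcone => ?_ }⟩
  · have hR := hlin x y (hx.trans_lt hlt₁) (hy.trans_lt hlt₁)
    set d := x - y with hd
    set ρ := F x - F y - A d with hρ
    have hFxy : F x - F y = A d + ρ := by rw [hρ]; abel
    set u := ⟪d, e⟫ with hu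
    have hAde : ⟪A d, e⟫ = 0 := by rw [hsymm, hAe, inner_zero_right]
    have hz : ⟪d - u • e, e⟫ = 0 := by
      rw [inner_sub_left, inner_smul_left, real_inner_self_eq_norm_sq, he, ← hu]
      simp
    have hAz := hcoer _ hz
    have hnz : ‖d - u • e‖ ^ 2 = ‖d‖ ^ 2 - u ^ 2 := by
      rw [norm_sub_sq_real, inner_smul_right, norm_smul, he, ← hu, mul_one,
        Real.norm_eq_abs, sq_abs]
      ring
    rw [hnz, map_sub, map_smul, hAe, smul_zero, sub_zero, inner_sub_right, inner_smul_right, hAde,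
      mul_zero, sub_zero] at hAz
    rw [coneForm, ← hu] at hxy
    have hρd : |⟪d, ρ⟫| ≤ δ * ‖d‖ ^ 2 := by
      calc _ ≤ ‖d‖ * ‖ρ‖ := abs_real_inner_le_norm _ _
        _ ≤ ‖d‖ * (δ * ‖d‖) := by gcongr
        _ = _ := by ring
    have hρe : |u * ⟪ρ, e⟫| ≤ δ * ‖d‖ ^ 2 := by
      have h1 : |u| ≤ ‖d‖ := by simpa [he] using abs_real_inner_le_norm d e
      have h2 : |⟪ρ, e⟫| ≤ δ * ‖d‖ :=
        (by simpa [he] using abs_real_inner_le_norm ρ e : |⟪ρ, e⟫| ≤ ‖ρ‖).trans hR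
      rw [abs_mul]
      calc _ ≤ ‖d‖ * (δ * ‖d‖) := by gcongr
        _ = _ := by ring
    have h1 := (abs_le.1 hρd).1
    have h2 := (abs_le.1 hρe).2
    have h3 : q * (u * ⟪ρ, e⟫) ≤ 2 * (δ * ‖d‖ ^ 2) := by
      have : 0 ≤ δ * ‖d‖ ^ 2 := by positivity
      calc _ ≤ q * (δ * ‖d‖ ^ 2) := by gcongr
        _ ≤ _ := by gcongr; linarith
    have h4 : κ ^ 2 / 2 * ‖d‖ ^ 2 ≤ ‖d‖ ^ 2 - u ^ 2 := by
      have : 0 ≤ ‖d‖ ^ 2 * (1 - κ ^ 2) * κ ^ 2 :=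
        mul_nonneg (mul_nonneg (by positivity) (by linarith)) hκsq0.le
      have : 0 ≤ (1 + κ ^ 2) * (‖d‖ ^ 2 - u ^ 2 - κ ^ 2 / 2 * ‖d‖ ^ 2) := by
        rw [hq] at hxy
        linarith
      have := nonneg_of_mul_nonneg_right this (by positivity)
      linarith
    have h5 := mul_le_mul_of_nonneg_left h4 hμ.le
    have h6 : 3 * (δ * ‖d‖ ^ 2) = μ * (κ ^ 2 / 2 * ‖d‖ ^ 2) := by rw [hδ]; ring
    rw [hFxy, inner_add_left, inner_add_right, hAde, zero_add, real_inner_comm (A d) d, mul_assoc]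
    linarith
  · have hT := htaylor (x - ξ) (hx.trans_lt hlt₂)
    rw [add_sub_cancel] at hT
    have hBv := bilin_le_of_coneForm_nonpos B he hκ0.le hκ1 hcone
    have h1 := (abs_le.1 hT).2
    rw [coneForm] at hcone
    set u := ⟪x - ξ, e⟫ with hu
    have h2 : ‖x - ξ‖ ^ 2 ≤ 2 * u ^ 2 := by nlinarith [sq_nonneg u]
    have h3 : (B e e + 3 * κ * ‖B‖) * u ^ 2 ≤ (-b + b / 4) * u ^ 2 := by
      gcongr
      linarith
    have h4 : b / 16 * ‖x - ξ‖ ^ 2 ≤ b / 16 * (2 * u ^ 2) := by gcongr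
    change b / 4 * u ^ 2 ≤ -f x
    linarith

end Gradient

section GradientField

variable {E : Type*} [NormedAddCommGroup E] [InnerProductSpace ℝ E] [CompleteSpace E]

lemma contDiff_gradient {g : E → ℝ} (hg : ContDiff ℝ 3 g) : ContDiff ℝ 2 (gradient g) :=
  (InnerProductSpace.toDual ℝ E).symm.contDiff.comp (hg.fderiv_right (m := 2) (by norm_num))

lemma inner_fderiv_gradient {g : E → ℝ} (hg : ContDiff ℝ 3 g) (ξ x y : E) :
    ⟪fderiv ℝ (gradient g) ξ x, y⟫ = fderiv ℝ (fderiv ℝ g) ξ x y := by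
  have hd : DifferentiableAt ℝ (fderiv ℝ g) ξ :=
    (hg.fderiv_right (m := 2) (by norm_num)).differentiable (by norm_num) ξ
  have hG : DifferentiableAt ℝ (gradient g) ξ :=
    (contDiff_gradient hg).differentiable (by norm_num) ξ
  have heq : (fun z => ⟪gradient g z, y⟫) = fun z => fderiv ℝ g z y :=
    funext fun z => InnerProductSpace.toDual_symm_apply
  have h1 := congrArg (fun f => fderiv ℝ f ξ x) heq
  rw [fderiv_inner_apply ℝ hG (differentiableAt_const y),
    fderiv_clm_apply hd (differentiableAt_const y)] at h1
  simpa using h1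

lemma fderiv_fderiv_inner_gradient {g : E → ℝ} (hg : ContDiff ℝ 3 g) (ξ e : E) :
    fderiv ℝ (fderiv ℝ fun x => ⟪gradient g x, e⟫) ξ e e = iteratedFDeriv ℝ 3 g ξ ![e, e, e] := by
  have h1 : (fun x => ⟪gradient g x, e⟫) =
      ContinuousLinearMap.apply ℝ ℝ e ∘ fderiv ℝ g := by
    funext x
    exact InnerProductSpace.toDual_symm_apply
  have h2 := (ContinuousLinearMap.apply ℝ ℝ e).iteratedFDeriv_comp_left (i := 2) (x := ξ)
    (hg.fderiv_right (m := 2) (by norm_num)).contDiffAt le_rfl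
  rw [← h1] at h2
  have h3 := congrArg (fun T => T ![e, e]) h2
  rw [iteratedFDeriv_two_apply] at h3
  rw [iteratedFDeriv_succ_apply_right]
  have h4 : Fin.init ![e, e, e] = ![e, e] := by
    ext i
    fin_cases i <;> rfl
  rw [h4]
  exact h3

end GradientField

/-- existence and uniqueness up to time-translation of the heteroclinic
solution of `ẇ = −∇g(w)` issuing (as `s → −∞`) from a degenerate critical point `ξ`
whose Hessian is positive semidefinite with one-dimensional kernel `span ℓ`, under the
transversality condition on the third derivative in the direction `ℓ`. -/
theorem heteroclinic_exists_unique
    {n : ℕ} (hn : 1 ≤ n)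
    (g : EuclideanSpace ℝ (Fin n) → ℝ) (hg : ContDiff ℝ 3 g)
    {a₀ c₀ : ℝ} (ha₀ : 0 ≤ a₀) (hc₀ : 0 < c₀)
    (hcoer : ∀ x : EuclideanSpace ℝ (Fin n), ⟪gradient g x, x⟫ ≥ c₀ * ‖x‖ ^ 2 - a₀)
    (ξ : EuclideanSpace ℝ (Fin n)) (hcrit : gradient g ξ = 0)
    (hpsd : ∀ y : EuclideanSpace ℝ (Fin n), 0 ≤ ⟪(fderiv ℝ (gradient g) ξ) y, y⟫)
    (ℓ : EuclideanSpace ℝ (Fin n)) (hℓ : ℓ ≠ 0)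
    (hker : LinearMap.ker (fderiv ℝ (gradient g) ξ).toLinearMap = Submodule.span ℝ {ℓ})
    (hthird : iteratedFDeriv ℝ 3 g ξ ![ℓ, ℓ, ℓ] ≠ 0) :
    (∃ w : ℝ → EuclideanSpace ℝ (Fin n),
      (∀ s : ℝ, HasDerivAt w (-(gradient g (w s))) s) ∧
      Tendsto w atBot (nhds ξ) ∧
      (∃ s₁ s₂ : ℝ, w s₁ ≠ w s₂)) ∧
    (∀ w₁ w₂ : ℝ → EuclideanSpace ℝ (Fin n),
      (∀ s : ℝ, HasDerivAt w₁ (-(gradient g (w₁ s))) s) →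
      Tendsto w₁ atBot (nhds ξ) → (∃ s₁ s₂ : ℝ, w₁ s₁ ≠ w₁ s₂) →
      (∀ s : ℝ, HasDerivAt w₂ (-(gradient g (w₂ s))) s) →
      Tendsto w₂ atBot (nhds ξ) → (∃ s₁ s₂ : ℝ, w₂ s₁ ≠ w₂ s₂) →
      ∃ c : ℝ, ∀ s : ℝ, w₂ s = w₁ (s + c)) := by
  set F := gradient g with hF
  have hC : ContDiff ℝ 2 F := contDiff_gradient hg
  have hsymm : ∀ x y, ⟪fderiv ℝ F ξ x, y⟫ = ⟪x, fderiv ℝ F ξ y⟫ := by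
    intro x y
    rw [real_inner_comm (fderiv ℝ F ξ y) x, inner_fderiv_gradient hg, inner_fderiv_gradient hg]
    exact (hg.contDiffAt.isSymmSndFDerivAt (by norm_num [minSmoothness])) x y
  obtain ⟨a, ha, hna, hsign⟩ : ∃ a : ℝ, a ≠ 0 ∧ ‖a • ℓ‖ = 1 ∧
      a * iteratedFDeriv ℝ 3 g ξ ![ℓ, ℓ, ℓ] < 0 := by
    have hn : 0 < ‖ℓ‖ := norm_pos_iff.2 hℓ
    rcases hthird.lt_or_gt with h | h
    · exact ⟨‖ℓ‖⁻¹, by positivity, by simp [norm_smul, hn.ne'],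
        mul_neg_of_pos_of_neg (by positivity) h⟩
    · exact ⟨-‖ℓ‖⁻¹, neg_ne_zero.2 (by positivity), by simp [norm_smul, hn.ne'],
        mul_neg_of_neg_of_pos (neg_neg_of_pos (by positivity)) h⟩
  have hneg : fderiv ℝ (fderiv ℝ fun x => ⟪F x, a • ℓ⟫) ξ (a • ℓ) (a • ℓ) < 0 := by
    rw [fderiv_fderiv_inner_gradient hg]
    have h1 : ![a • ℓ, a • ℓ, a • ℓ] = fun i => (fun _ => a) i • ![ℓ, ℓ, ℓ] i := by
      ext i
      fin_cases i <;> rfl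
    rw [h1, ContinuousMultilinearMap.map_smul_univ]
    simp only [Finset.prod_const, Finset.card_univ, Fintype.card_fin, smul_eq_mul]
    have : 0 < a ^ 2 := by positivity
    nlinarith
  have hspan : LinearMap.ker (fderiv ℝ F ξ).toLinearMap = Submodule.span ℝ {a • ℓ} := by
    rw [hker, Submodule.span_singleton_smul_eq ha.isUnit]
  obtain ⟨q, c, r, hcone⟩ := exists_isConeField hC hna hcrit hsymm hpsd hspan hneg
  have hC1 : ContDiff ℝ 1 F := hC.of_le (by norm_num)
  exact ⟨hcone.exists_solution_of_coercive hC1 hc₀ hcoer,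
    fun w₁ w₂ h₁ l₁ n₁ h₂ l₂ n₂ => hcone.eq_translate hC1 h₁ l₁ n₁ h₂ l₂ n₂⟩
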